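/- For all constant integers h and k with k ≤ h, and every constant D, the following holds: on the class of connected n-vertex graphs of diameter at most D whose vertices carry distinct identifiers all belonging to the interval {1+k, …, n+h}, the property AMOS admits a 1-local proof-labeling scheme of size O(log D) (the hidden constant depending only on h and k). -/

import Mathlib

open SimpleGraph Filter

/-- A network configuration: a finite connected simple graph whose vertices carry
an input bit (`sel`, "selected") and distinct identifiers (`ids`). -/
structure Network where
  n : ℕ
  G : SimpleGraph (Fin n)
  conn : G.Connected
  sel : Fin n → Bool
  ids : Fin n → ℕ
  ids_inj : Function.Injective ids

/-- AMOS: at most one vertex is selected. -/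
def Network.AMOS (N : Network) : Prop :=
  ∀ u v : Fin N.n, N.sel u = true → N.sel v = true → u = v

/-- The radius-`r` ball around `v`. -/
def Network.ball (N : Network) (r : ℕ) (v : Fin N.n) : Set (Fin N.n) :=
  {u : Fin N.n | N.G.dist v u ≤ r}

lemma Network.center_mem_ball (N : Network) (r : ℕ) (v : Fin N.n) :
    v ∈ N.ball r v := by
  simp [Network.ball, SimpleGraph.dist_self]

/-- A verifier: at each vertex of each network, given certificates (bit strings),
it accepts (`true`) or rejects (`false`). -/
def Verifier : Type :=
  ∀ N : Network, (Fin N.n → List Bool) → Fin N.n → Bool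

/-- `r`-locality: the decision at `v` only depends on the radius-`r` ball around `v`,
i.e. on the subgraph induced by the vertices at distance at most `r` from `v`,
together with the input bits, the identifiers and the certificates in the ball. -/
def IsLocalVerifier (r : ℕ) (A : Verifier) : Prop :=
  ∀ (N N' : Network) (P : Fin N.n → List Bool) (P' : Fin N'.n → List Bool)
    (v : Fin N.n) (v' : Fin N'.n)
    (φ : (N.G.induce (N.ball r v)) ≃g (N'.G.induce (N'.ball r v'))),
    (∀ x : N.ball r v, N.sel x.1 = N'.sel (φ x).1) →
    (∀ x : N.ball r v, N.ids x.1 = N'.ids (φ x).1) →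
    (∀ x : N.ball r v, P x.1 = P' (φ x).1) →
    φ ⟨v, N.center_mem_ball r v⟩ = ⟨v', N'.center_mem_ball r v'⟩ →
    A N P v = A N' P' v'

/-- An `r`-local proof-labeling scheme of size `size` for the property `Pr`
on the class of networks `Net`: a prover assigning certificates of at most
`size n` bits on yes-instances (completeness), such that on no-instances every
certificate assignment is rejected at some vertex (soundness). -/
structure PLS (r : ℕ) (size : ℕ → ℕ) (Net : Network → Prop) (Pr : Network → Prop) where
  prover : ∀ N : Network, Fin N.n → List Bool
  verifier : Verifier
  verifier_local : IsLocalVerifier r verifier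
  prover_size : ∀ N : Network, Net N → Pr N → ∀ v, (prover N v).length ≤ size N.n
  completeness : ∀ N : Network, Net N → Pr N → ∀ v, verifier N (prover N) v = true
  soundness : ∀ N : Network, Net N → ¬ Pr N →
    ∀ P : Fin N.n → List Bool, ∃ v, verifier N P v = false

/-- The identifiers and certificates of the neighbours of `v`. -/
def Network.neighborView (N : Network) (P : Fin N.n → List Bool) (v : Fin N.n) :
    Set (ℕ × List Bool) :=
  {x | ∃ u, N.G.Adj v u ∧ x = (N.ids u, P u)}

lemma Network.mem_ball_one_of_adj (N : Network) {v u : Fin N.n} (h : N.G.Adj v u) :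
    u ∈ N.ball 1 v := by
  simp [Network.ball, SimpleGraph.dist_eq_one_iff_adj.mpr h]

lemma Network.neighborView_subset {N N' : Network} {P : Fin N.n → List Bool}
    {P' : Fin N'.n → List Bool} {v : Fin N.n} {v' : Fin N'.n}
    (φ : (N.G.induce (N.ball 1 v)) ≃g (N'.G.induce (N'.ball 1 v')))
    (hids : ∀ x : N.ball 1 v, N.ids x.1 = N'.ids (φ x).1)
    (hP : ∀ x : N.ball 1 v, P x.1 = P' (φ x).1)
    (hv : φ ⟨v, N.center_mem_ball 1 v⟩ = ⟨v', N'.center_mem_ball 1 v'⟩) :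
    N.neighborView P v ⊆ N'.neighborView P' v' := by
  rintro _ ⟨u, hu, rfl⟩
  let x : N.ball 1 v := ⟨u, N.mem_ball_one_of_adj hu⟩
  have hadj : (N.G.induce (N.ball 1 v)).Adj ⟨v, N.center_mem_ball 1 v⟩ x := hu
  have hadj' := φ.map_adj_iff.mpr hadj
  rw [hv] at hadj'
  exact ⟨(φ x).1, hadj', Prod.ext (hids x) (hP x)⟩

/-- A verifier that only looks at the centre and at the set of pairs (identifier, certificate)
of its neighbours is `1`-local. -/
lemma isLocalVerifier_of_neighborView
    (B : Bool → ℕ → List Bool → Set (ℕ × List Bool) → Bool) :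
    IsLocalVerifier 1 (fun N P v => B (N.sel v) (N.ids v) (P v) (N.neighborView P v)) := by
  intro N N' P P' v v' φ hsel hids hP hv
  have hs := hsel ⟨v, N.center_mem_ball 1 v⟩
  have hi := hids ⟨v, N.center_mem_ball 1 v⟩
  have hp := hP ⟨v, N.center_mem_ball 1 v⟩
  rw [hv] at hs hi hp
  have hview : N.neighborView P v = N'.neighborView P' v' := by
    apply Set.Subset.antisymm (Network.neighborView_subset φ hids hP hv)
    refine Network.neighborView_subset φ.symm (fun x => ?_) (fun x => ?_) ?_
    · rw [hids, φ.apply_symm_apply]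
    · rw [hP, φ.apply_symm_apply]
    · rw [← hv, φ.symm_apply_apply]
  simp only at hs hi hp ⊢
  rw [hs, hi, hp, hview]

/-- A certificate stores the identifier of a leader, a distance to that leader, and a mark. -/
def encodeCert (leader depth : ℕ) (mark : Bool) : List Bool :=
  mark :: (Nat.pair leader depth).bits

def certMark (c : List Bool) : Bool := c.headD false

noncomputable def certPair (c : List Bool) : ℕ × ℕ :=
  Nat.unpair (Function.invFun Nat.bits c.tail)

noncomputable def certLeader (c : List Bool) : ℕ := (certPair c).1

noncomputable def certDepth (c : List Bool) : ℕ := (certPair c).2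

lemma nat_bits_injective : Function.Injective Nat.bits := by
  intro a
  induction a using Nat.binaryRec' with
  | zero =>
    intro b hb
    by_contra hne
    have := Nat.size_pos.mpr (Nat.pos_of_ne_zero (Ne.symm hne))
    rw [← Nat.size_eq_bits_len, ← hb] at this
    simp at this
  | bit x a hx ih =>
    intro b
    induction b using Nat.binaryRec' with
    | zero => intro hb; rw [Nat.bits_append_bit _ _ hx] at hb; simp at hb
    | bit y b hy _ =>
      intro hb
      rw [Nat.bits_append_bit _ _ hx, Nat.bits_append_bit _ _ hy] at hb
      obtain ⟨rfl, hab⟩ := List.cons.inj hb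
      rw [ih hab]

lemma certMark_encodeCert (l d : ℕ) (m : Bool) : certMark (encodeCert l d m) = m := rfl

lemma certPair_encodeCert (l d : ℕ) (m : Bool) : certPair (encodeCert l d m) = (l, d) := by
  simp [certPair, encodeCert, Function.leftInverse_invFun nat_bits_injective _]

lemma certLeader_encodeCert (l d : ℕ) (m : Bool) : certLeader (encodeCert l d m) = l := by
  rw [certLeader, certPair_encodeCert]

lemma certDepth_encodeCert (l d : ℕ) (m : Bool) : certDepth (encodeCert l d m) = d := by
  rw [certDepth, certPair_encodeCert]

lemma length_encodeCert_le {l d H D : ℕ} (m : Bool) (hl : l ≤ H) (hd : d ≤ D) :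
    (encodeCert l d m).length ≤ (2 * H + 5) * (Nat.log 2 D + 1) := by
  have hsize : (Nat.pair l d).size ≤ 2 * (H + (Nat.log 2 D + 1)) := by
    rw [Nat.size_le]
    have h1 : l + 1 ≤ 2 ^ H := lt_of_le_of_lt hl Nat.lt_two_pow_self
    have h2 : d + 1 ≤ 2 ^ (Nat.log 2 D + 1) :=
      lt_of_le_of_lt hd (Nat.lt_pow_succ_log_self (by norm_num) D)
    have h3 : max l d + 1 ≤ 2 ^ (H + (Nat.log 2 D + 1)) := by
      rw [pow_add]
      rcases max_choice l d with h | h <;> rw [h] <;> nlinarith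
    calc Nat.pair l d < (max l d + 1) ^ 2 := Nat.pair_lt_max_add_one_sq l d
      _ ≤ (2 ^ (H + (Nat.log 2 D + 1))) ^ 2 := Nat.pow_le_pow_left h3 2
      _ = 2 ^ (2 * (H + (Nat.log 2 D + 1))) := by rw [← pow_mul, mul_comm]
  rw [encodeCert, List.length_cons, Nat.size_eq_bits_len]
  nlinarith

/-- The local check: leaders agree, depth `0` is reserved to the leader, selected vertices are
marked, and the marked vertices form a path descending to the leader, which stops at a
selected vertex. -/
structure LocalCheck (sel : Bool) (i : ℕ) (c : List Bool) (S : Set (ℕ × List Bool)) : Prop where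
  leader_eq : ∀ x ∈ S, certLeader x.2 = certLeader c
  eq_leader : certDepth c = 0 → i = certLeader c
  mark_of_sel : sel = true → certMark c = true
  exists_pred : certMark c = true → certDepth c ≠ 0 →
    ∃ x ∈ S, certMark x.2 = true ∧ certDepth x.2 + 1 = certDepth c
  succ_unique : certMark c = true → ∀ x ∈ S, ∀ y ∈ S, certMark x.2 = true →
    certMark y.2 = true → certDepth x.2 = certDepth c + 1 →
    certDepth y.2 = certDepth c + 1 → x.1 = y.1
  not_succ_of_sel : sel = true → ∀ x ∈ S, certMark x.2 = true →
    certDepth x.2 ≠ certDepth c + 1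

/-- If every vertex passes the local check then at most one vertex is selected. -/
lemma Network.amos_of_localCheck (N : Network) (P : Fin N.n → List Bool)
    (hc : ∀ v, LocalCheck (N.sel v) (N.ids v) (P v) (N.neighborView P v)) : N.AMOS := by
  have hleader : ∀ u v, certLeader (P u) = certLeader (P v) := by
    intro u v
    obtain ⟨p⟩ := N.conn.preconnected u v
    induction p with
    | nil => rfl
    | cons hadj _ ih => rw [← ih, (hc _).leader_eq _ ⟨_, hadj, rfl⟩]
  have hpred : ∀ v, certMark (P v) = true → certDepth (P v) ≠ 0 →
      ∃ u, N.G.Adj v u ∧ certMark (P u) = true ∧ certDepth (P u) + 1 = certDepth (P v) := by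
    intro v hm hd
    obtain ⟨_, ⟨u, hu, rfl⟩, h⟩ := (hc v).exists_pred hm hd
    exact ⟨u, hu, h⟩
  have hlevel : ∀ d u v, certMark (P u) = true → certMark (P v) = true →
      certDepth (P u) = d → certDepth (P v) = d → u = v := by
    intro d
    induction d with
    | zero =>
      intro u v _ _ hu hv
      apply N.ids_inj
      rw [(hc u).eq_leader hu, (hc v).eq_leader hv, hleader u v]
    | succ d ih =>
      intro u v hmu hmv hu hv
      obtain ⟨u', hau, hmu', hu'⟩ := hpred u hmu (by omega)
      obtain ⟨v', hav, hmv', hv'⟩ := hpred v hmv (by omega)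
      obtain rfl := ih u' v' hmu' hmv' (by omega) (by omega)
      exact N.ids_inj ((hc u').succ_unique hmu' _ ⟨u, hau.symm, rfl⟩ _ ⟨v, hav.symm, rfl⟩
        hmu hmv hu'.symm hv'.symm)
  have hdescend : ∀ j v e, certMark (P v) = true → certDepth (P v) = e + 1 + j →
      ∃ w w', N.G.Adj w w' ∧ certMark (P w) = true ∧ certMark (P w') = true ∧
        certDepth (P w) = e ∧ certDepth (P w') = e + 1 := by
    intro j
    induction j with
    | zero =>
      intro v e hm hd
      obtain ⟨u, hau, hmu, hu⟩ := hpred v hm (by omega)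
      exact ⟨u, v, hau.symm, hmu, hm, by omega, by omega⟩
    | succ j ih =>
      intro v e hm hd
      obtain ⟨u, _, hmu, hu⟩ := hpred v hm (by omega)
      exact ih u e hmu (by omega)
  have hnotlt : ∀ u v, N.sel u = true → N.sel v = true →
      ¬ certDepth (P u) < certDepth (P v) := by
    intro u v hsu hsv hlt
    obtain ⟨w, w', hadj, hmw, hmw', hw, hw'⟩ :=
      hdescend (certDepth (P v) - (certDepth (P u) + 1)) v (certDepth (P u))
        ((hc v).mark_of_sel hsv) (by omega)
    obtain rfl := hlevel _ w u hmw ((hc u).mark_of_sel hsu) hw rfl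
    exact (hc w).not_succ_of_sel hsu _ ⟨w', hadj, rfl⟩ hmw' hw'
  intro u v hu hv
  exact hlevel _ u v ((hc u).mark_of_sel hu) ((hc v).mark_of_sel hv) rfl
    (le_antisymm (not_lt.mp (hnotlt u v hu hv)) (not_lt.mp (hnotlt v u hv hu)))

/-- On a yes-instance, a set of marked vertices along a shortest path from `r` to the selected
vertex: marked vertices are determined by their distance to `r`. -/
lemma Network.AMOS.exists_mark {N : Network} (hN : N.AMOS) (r : Fin N.n) :
    ∃ m : Fin N.n → Bool,
      (∀ v, N.sel v = true → m v = true) ∧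
      (∀ v, m v = true → N.G.dist r v ≠ 0 →
        ∃ u, N.G.Adj v u ∧ m u = true ∧ N.G.dist r u + 1 = N.G.dist r v) ∧
      (∀ u v, m u = true → m v = true → N.G.dist r u = N.G.dist r v → u = v) ∧
      (∀ u v, N.sel u = true → m v = true → N.G.dist r v ≤ N.G.dist r u) := by
  classical
  by_cases hs : ∃ s, N.sel s = true
  · obtain ⟨s, hs⟩ := hs
    obtain ⟨p, hp⟩ := N.conn.exists_walk_length_eq_dist r s
    have hdist : ∀ i ≤ p.length, N.G.dist r (p.getVert i) = i := by
      intro i hi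
      have h1 := SimpleGraph.dist_le (p.take i)
      have h2 := SimpleGraph.dist_le (p.drop i)
      have h3 := N.conn.dist_triangle (u := r) (v := p.getVert i) (w := s)
      rw [SimpleGraph.Walk.take_length] at h1
      rw [SimpleGraph.Walk.drop_length] at h2
      omega
    have hmark : ∀ v, v ∈ p.support →
        N.G.dist r v ≤ p.length ∧ p.getVert (N.G.dist r v) = v := by
      intro v hv
      obtain ⟨i, rfl, hi⟩ := SimpleGraph.Walk.mem_support_iff_exists_getVert.mp hv
      rw [hdist i hi]
      exact ⟨hi, rfl⟩
    refine ⟨fun v => decide (v ∈ p.support), fun v hv => ?_, fun v hv hd => ?_,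
      fun u v hu hv huv => ?_, fun u v hu hv => ?_⟩
    · obtain rfl := hN v s hv hs
      simp
    · obtain ⟨hle, hget⟩ := hmark v (of_decide_eq_true hv)
      obtain ⟨i, hi⟩ := Nat.exists_eq_succ_of_ne_zero hd
      have hadj := p.adj_getVert_succ (i := i) (by omega)
      rw [← Nat.succ_eq_add_one, ← hi, hget] at hadj
      refine ⟨p.getVert i, hadj.symm, by simp [SimpleGraph.Walk.getVert_mem_support], ?_⟩
      rw [hdist i (by omega), hi]
    · rw [← (hmark u (of_decide_eq_true hu)).2, huv, (hmark v (of_decide_eq_true hv)).2]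
    · obtain rfl := hN u s hu hs
      rw [← hp]
      exact (hmark v (of_decide_eq_true hv)).1
  · push Not at hs
    exact ⟨fun _ => false, fun v hv => absurd hv (hs v), by simp, by simp, by simp⟩

/-- On a yes-instance every leader can be certified. -/
lemma Network.AMOS.exists_localCheck {N : Network} (hN : N.AMOS) (r : Fin N.n) :
    ∃ m : Fin N.n → Bool, ∀ v,
      LocalCheck (N.sel v) (N.ids v) (encodeCert (N.ids r) (N.G.dist r v) (m v))
        (N.neighborView (fun u => encodeCert (N.ids r) (N.G.dist r u) (m u)) v) := by
  obtain ⟨m, hsel, hpred, huniq, hlast⟩ := hN.exists_mark r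
  refine ⟨m, fun v => ⟨?_, ?_, ?_, ?_, ?_, ?_⟩⟩ <;>
    simp only [certMark_encodeCert, certDepth_encodeCert, certLeader_encodeCert]
  · rintro _ ⟨u, _, rfl⟩
    simp only [certLeader_encodeCert]
  · intro h
    rw [(N.conn.dist_eq_zero_iff).mp h]
  · exact hsel v
  · intro hm hd
    obtain ⟨u, hu, hmu, hdu⟩ := hpred v hm hd
    exact ⟨_, ⟨u, hu, rfl⟩, by simpa only [certMark_encodeCert, certDepth_encodeCert] using
      ⟨hmu, hdu⟩⟩
  · rintro _ _ ⟨u, _, rfl⟩ _ ⟨w, _, rfl⟩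
    simp only [certMark_encodeCert, certDepth_encodeCert]
    intro hu hw hdu hdw
    rw [huniq u w hu hw (hdu.trans hdw.symm)]
  · rintro hs _ ⟨u, _, rfl⟩
    simp only [certMark_encodeCert, certDepth_encodeCert]
    intro hu hdu
    have := hlast v u hs hu
    omega

/-- If all identifiers are at most `n + h`, then some identifier is at most `1 + h`. -/
lemma Network.exists_ids_le (N : Network) (h : ℤ)
    (hids : ∀ v, (N.ids v : ℤ) ≤ (N.n : ℤ) + h) : ∃ v, N.ids v ≤ (1 + h).toNat := by
  by_contra! hlt
  obtain ⟨v₀⟩ := N.conn.nonempty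
  have hpos : 0 < N.n := v₀.pos
  have hcard : (Finset.univ : Finset (Fin N.n)).card ≤
      (Finset.Icc (h + 2) ((N.n : ℤ) + h)).card := by
    refine Finset.card_le_card_of_injOn (fun v => (N.ids v : ℤ)) (fun v _ => ?_) ?_
    · have := hlt v
      simp only [Finset.coe_Icc, Set.mem_Icc]
      exact ⟨by omega, hids v⟩
    · exact fun u _ v _ huv => N.ids_inj (Int.ofNat_inj.mp huv)
  rw [Finset.card_univ, Fintype.card_fin, Int.card_Icc] at hcard
  omega

/-- If the identifiers of the `n` vertices all lie in `{1+k, …, n+h}` for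
constant integers `k ≤ h`, then AMOS on graphs of bounded diameter `D` can be
certified with `O(log D)` bits (the hidden constant depending only on `h` and
`k`): there is a 1-local proof-labeling scheme of size `K · (log D + 1)` on
connected `n`-vertex graphs of diameter at most `D` whose distinct identifiers
all belong to `{1+k, …, n+h}`. -/
theorem amos_small_id_range_log_diameter (h k : ℤ) (hkh : k ≤ h) :
    ∃ K : ℕ, ∀ D : ℕ, 1 ≤ D →
      Nonempty (PLS 1 (fun _ => K * (Nat.log 2 D + 1))
        (fun N => (∀ u v : Fin N.n, N.G.dist u v ≤ D) ∧
          (∀ v : Fin N.n, 1 + k ≤ (N.ids v : ℤ) ∧ (N.ids v : ℤ) ≤ (N.n : ℤ) + h))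
        Network.AMOS) := by
  classical
  refine ⟨2 * (1 + h).toNat + 5, fun D _ => ?_⟩
  have hprover : ∀ N : Network, ∃ P : Fin N.n → List Bool,
      ((∀ u v : Fin N.n, N.G.dist u v ≤ D) ∧
        (∀ v : Fin N.n, 1 + k ≤ (N.ids v : ℤ) ∧ (N.ids v : ℤ) ≤ (N.n : ℤ) + h)) → N.AMOS →
      ∀ v, (P v).length ≤ (2 * (1 + h).toNat + 5) * (Nat.log 2 D + 1) ∧
        LocalCheck (N.sel v) (N.ids v) (P v) (N.neighborView P v) := by
    intro N
    by_cases hN : ((∀ u v : Fin N.n, N.G.dist u v ≤ D) ∧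
        (∀ v : Fin N.n, 1 + k ≤ (N.ids v : ℤ) ∧ (N.ids v : ℤ) ≤ (N.n : ℤ) + h)) ∧ N.AMOS
    · obtain ⟨⟨hD, hids⟩, hA⟩ := hN
      obtain ⟨r, hr⟩ := N.exists_ids_le h fun v => (hids v).2
      obtain ⟨m, hm⟩ := hA.exists_localCheck r
      exact ⟨_, fun _ _ v => ⟨length_encodeCert_le (m v) hr (hD r v), hm v⟩⟩
    · exact ⟨fun _ => [], fun h1 h2 => absurd ⟨h1, h2⟩ hN⟩
  choose prover hprover using hprover
  exact ⟨{
    prover := prover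
    verifier := fun N P v =>
      decide (LocalCheck (N.sel v) (N.ids v) (P v) (N.neighborView P v))
    verifier_local := isLocalVerifier_of_neighborView fun s i c S => decide (LocalCheck s i c S)
    prover_size := fun N hN hA v => (hprover N hN hA v).1
    completeness := fun N hN hA v => decide_eq_true (hprover N hN hA v).2
    soundness := fun N _ hA P => by
      by_contra! hacc
      exact hA (N.amos_of_localCheck P fun v =>
        of_decide_eq_true (Bool.eq_true_of_not_eq_false (hacc v))) }⟩
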